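/- Let G be a finite simple graph with arboricity at most α, let 0 < ε ≤ 1, and set Δ = 5(5/ε + 1)·2α. Let G_Δ be the subgraph obtained by having every vertex mark up to Δ incident edges (vertices of degree < Δ marking all their incident edges, other vertices marking Δ arbitrary incident edges) and keeping exactly the edges marked by both endpoints. Then the maximum matching size of G is at most (1+ε) times the maximum matching size of G_Δ. -/

import Mathlib

open Finset SimpleGraph

/-- `N` is a matching using only edges from the edge set `s`:
its members lie in `s` and are pairwise vertex-disjoint. -/
def IsMatchingIn {V : Type*} (s : Set (Sym2 V)) (N : Finset (Sym2 V)) : Prop :=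
  (↑N : Set (Sym2 V)) ⊆ s ∧
    ∀ e ∈ N, ∀ f ∈ N, e ≠ f → ∀ v : V, v ∈ e → v ∉ f

/-- In a graph of arboricity at most `α`, the sum over `S` of the degrees inside `S` is at most
`2 * α * #S`. -/
theorem sum_card_adj_le {V : Type*} [Fintype V] [DecidableEq V]
    (G : SimpleGraph V) [DecidableRel G.Adj] {α : ℝ} (hα : 0 ≤ α)
    (harb : ∀ S : Finset V, 2 ≤ S.card →
      ((G.edgeFinset.filter fun e => ∀ v ∈ e, v ∈ S).card : ℝ) ≤ α * ((S.card : ℝ) - 1))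
    (S : Finset V) :
    ((∑ v ∈ S, (S.filter (G.Adj v)).card : ℕ) : ℝ) ≤ 2 * α * S.card := by
  by_cases hS : 2 ≤ S.card
  · have hsum : ∑ v ∈ S, (S.filter (G.Adj v)).card =
        ((S ×ˢ S).filter fun p => G.Adj p.1 p.2).card := by
      simp only [Finset.card_filter, Finset.sum_product]
    have hfiber := Finset.card_le_mul_card_image (f := fun p : V × V => s(p.1, p.2))
      ((S ×ˢ S).filter fun p => G.Adj p.1 p.2) 2 (by
        intro e _
        induction e with
        | _ a b =>
          refine (Finset.card_le_card (t := {(a, b), (b, a)}) ?_).trans Finset.card_le_two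
          rintro ⟨x, y⟩ hx
          simpa using (Finset.mem_filter.1 hx).2)
    have himage : (((S ×ˢ S).filter fun p => G.Adj p.1 p.2).image
        fun p : V × V => s(p.1, p.2)) ⊆ G.edgeFinset.filter fun e => ∀ v ∈ e, v ∈ S := by
      intro e he
      obtain ⟨⟨x, y⟩, hp, rfl⟩ := Finset.mem_image.1 he
      simp only [Finset.mem_filter, Finset.mem_product] at hp
      simp [hp.1.1, hp.1.2, hp.2]
    have hle : (((S ×ˢ S).filter fun p => G.Adj p.1 p.2).card : ℝ) ≤
        2 * ((G.edgeFinset.filter fun e => ∀ v ∈ e, v ∈ S).card : ℝ) := by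
      exact_mod_cast hfiber.trans (Nat.mul_le_mul_left 2 (Finset.card_le_card himage))
    rw [hsum]
    linarith [harb S hS]
  · have hzero : ∑ v ∈ S, (S.filter (G.Adj v)).card = 0 := by
      refine Finset.sum_eq_zero fun v hv => Finset.card_eq_zero.2 ?_
      refine Finset.filter_eq_empty_iff.2 fun w hw hvw => hvw.ne ?_
      exact Finset.card_le_one.1 (by omega) v hv w hw
    rw [hzero]
    simp only [Nat.cast_zero]
    positivity

/-- Hall's condition in a sparse graph: if every vertex of `A` has a list of at least `4 * α`
neighbours, then one can choose distinct representatives of the lists. -/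
theorem exists_injective_of_four_mul_le_card {V : Type*} [Fintype V] [DecidableEq V]
    (G : SimpleGraph V) [DecidableRel G.Adj] {α : ℝ} (hα : 0 < α)
    (harb : ∀ S : Finset V, 2 ≤ S.card →
      ((G.edgeFinset.filter fun e => ∀ v ∈ e, v ∈ S).card : ℝ) ≤ α * ((S.card : ℝ) - 1))
    (A : Finset V) (T : V → Finset V) (hadj : ∀ v, ∀ w ∈ T v, G.Adj v w)
    (hT : ∀ v ∈ A, 4 * α ≤ ((T v).card : ℝ)) :
    ∃ f : A → V, Function.Injective f ∧ ∀ v : A, f v ∈ T v := by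
  refine (Finset.all_card_le_biUnion_card_iff_exists_injective fun v : A => T v).1 fun s => ?_
  set B := s.biUnion fun v : A => T v with hB
  set A' := s.map (Function.Embedding.subtype _) with hA'
  have hcard : A'.card = s.card := Finset.card_map _
  have hsub : A' ⊆ A' ∪ B := Finset.subset_union_left
  have hlow : (A'.card : ℝ) * (4 * α) ≤ ((∑ v ∈ A', (T v).card : ℕ) : ℝ) := by
    rw [Nat.cast_sum, ← nsmul_eq_mul]
    refine Finset.card_nsmul_le_sum _ _ _ fun v hv => hT v ?_
    obtain ⟨x, _, rfl⟩ := Finset.mem_map.1 hv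
    exact x.2
  have hmono : ∑ v ∈ A', (T v).card ≤
      ∑ v ∈ A' ∪ B, ((A' ∪ B).filter (G.Adj v)).card := by
    refine (Finset.sum_le_sum fun v hv => Finset.card_le_card fun w hw => ?_).trans
      (Finset.sum_le_sum_of_subset hsub)
    obtain ⟨x, hx, rfl⟩ := Finset.mem_map.1 hv
    exact Finset.mem_filter.2 ⟨Finset.mem_union_right _ (Finset.mem_biUnion.2 ⟨x, hx, hw⟩),
      hadj _ _ hw⟩
  have hup := sum_card_adj_le G hα.le harb (A' ∪ B)
  have hunion : ((A' ∪ B).card : ℝ) ≤ A'.card + B.card := by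
    exact_mod_cast Finset.card_union_le A' B
  have hmono' : ((∑ v ∈ A', (T v).card : ℕ) : ℝ) ≤
      ((∑ v ∈ A' ∪ B, ((A' ∪ B).filter (G.Adj v)).card : ℕ) : ℝ) := by
    exact_mod_cast hmono
  have hfinal : α * (A'.card : ℝ) ≤ α * B.card := by nlinarith
  rw [← hcard]
  exact_mod_cast le_of_mul_le_mul_left hfinal hα

/-- The number of edges of a matching meeting a vertex set `H` is at most `#H`. -/
theorem IsMatchingIn.card_filter_exists_mem_le {V : Type*} {s : Set (Sym2 V)}
    {N : Finset (Sym2 V)} (hN : IsMatchingIn s N) (H : Finset V)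
    [DecidablePred fun e : Sym2 V => ∃ v ∈ e, v ∈ H] :
    (N.filter fun e => ∃ v ∈ e, v ∈ H).card ≤ H.card := by
  refine Finset.card_le_card_of_forall_subsingleton (fun e v => v ∈ e) (fun e he => ?_) ?_
  · obtain ⟨v, hve, hvH⟩ := (Finset.mem_filter.1 he).2
    exact ⟨v, hvH, hve⟩
  · rintro v _ e ⟨he, hve⟩ f ⟨hf, hvf⟩
    by_contra hne
    exact hN.2 e (Finset.mem_filter.1 he).1 f (Finset.mem_filter.1 hf).1 hne v hve hvf

/-- If `v` has few marked neighbours outside `S`, it has many neighbours in `S`. -/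
theorem card_le_add_card_filter_adj {V : Type*} [Fintype V] [DecidableEq V]
    (G : SimpleGraph V) [DecidableRel G.Adj] {v : V} {E : Finset (Sym2 V)}
    (hE : E ⊆ G.incidenceFinset v) (S : Finset V) :
    E.card ≤ (univ.filter fun w => s(v, w) ∈ E ∧ w ∉ S).card + (S.filter (G.Adj v)).card := by
  have hsub : E ⊆ ((univ.filter fun w => s(v, w) ∈ E ∧ w ∉ S) ∪ S.filter (G.Adj v)).image
      fun w => s(v, w) := by
    intro e he
    have hinc := hE he
    rw [SimpleGraph.mem_incidenceFinset] at hinc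
    obtain ⟨w, rfl⟩ := Sym2.mem_iff_exists.1 hinc.2
    have hvw : G.Adj v w := hinc.1
    refine Finset.mem_image.2 ⟨w, ?_, rfl⟩
    by_cases hw : w ∈ S <;> simp [hw, he, hvw]
  exact (Finset.card_le_card hsub).trans (Finset.card_image_le.trans (Finset.card_union_le _ _))

/-- Replacing the edges of a matching `N` that meet `H` by edges `s(v, f v)`, `v ∈ A ⊆ H`, with
distinct endpoints `f v` outside `H` and not covered by `N`, yields a matching. -/
theorem IsMatchingIn.union_image {V : Type*} [DecidableEq V] {s t : Set (Sym2 V)}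
    {N : Finset (Sym2 V)} (hN : IsMatchingIn s N) {H A : Finset V} (hAH : A ⊆ H)
    (hkeep : ∀ e ∈ N, (∀ v ∈ e, v ∉ H) → e ∈ t)
    {f : A → V} (hf : Function.Injective f) (hft : ∀ v : A, s((v : V), f v) ∈ t)
    (hfH : ∀ v, f v ∉ H) (hfN : ∀ v, ∀ e ∈ N, f v ∉ e) :
    ∃ N' : Finset (Sym2 V), IsMatchingIn t N' ∧
      A.card ≤ N'.card ∧ N.card + A.card ≤ N'.card + H.card := by
  classical
  set N₀ := N.filter fun e => ¬ ∃ v ∈ e, v ∈ H with hN₀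
  set N₁ := A.attach.image fun v : A => s((v : V), f v) with hN₁
  have hcross : ∀ e ∈ N₀, ∀ v : A, ∀ w, w ∈ e → w ∉ s((v : V), f v) := by
    intro e he v w hwe hw
    obtain ⟨heN, heH⟩ := Finset.mem_filter.1 he
    rcases Sym2.mem_iff.1 hw with rfl | rfl
    · exact heH ⟨v, hwe, hAH v.2⟩
    · exact hfN v e heN hwe
  have hdisj : Disjoint N₀ N₁ := by
    refine Finset.disjoint_left.2 fun e he he' => ?_
    obtain ⟨v, _, rfl⟩ := Finset.mem_image.1 he'
    exact hcross _ he v v (Sym2.mem_mk_left _ _) (Sym2.mem_mk_left _ _)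
  have hinj : Function.Injective fun v : A => s((v : V), f v) := by
    intro v w hvw
    rcases Sym2.eq_iff.1 hvw with h | h
    · exact Subtype.ext h.1
    · exact absurd (hAH v.2) (h.1 ▸ hfH w)
  refine ⟨N₀ ∪ N₁, ⟨?_, ?_⟩, ?_⟩
  · intro e he
    rcases Finset.mem_union.1 (Finset.mem_coe.1 he) with he | he
    · obtain ⟨heN, heH⟩ := Finset.mem_filter.1 he
      exact hkeep e heN fun v hv hvH => heH ⟨v, hv, hvH⟩
    · obtain ⟨v, _, rfl⟩ := Finset.mem_image.1 he
      exact hft v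
  · intro e he e' he' hne w hw hw'
    rcases Finset.mem_union.1 he with he | he <;> rcases Finset.mem_union.1 he' with he' | he'
    · exact hN.2 e (Finset.mem_filter.1 he).1 e' (Finset.mem_filter.1 he').1 hne w hw hw'
    · obtain ⟨v, _, rfl⟩ := Finset.mem_image.1 he'
      exact hcross e he v w hw hw'
    · obtain ⟨v, _, rfl⟩ := Finset.mem_image.1 he
      exact hcross e' he' v w hw' hw
    · obtain ⟨v, _, rfl⟩ := Finset.mem_image.1 he
      obtain ⟨v', _, rfl⟩ := Finset.mem_image.1 he'
      have hvv : v ≠ v' := fun h => hne (by rw [h])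
      rcases Sym2.mem_iff.1 hw with rfl | rfl <;> rcases Sym2.mem_iff.1 hw' with h | h
      · exact hvv (Subtype.ext h)
      · exact hfH v' (h ▸ hAH v.2)
      · exact hfH v (h ▸ hAH v'.2)
      · exact hvv (hf h)
  · have hsplit : (N.filter fun e => ∃ v ∈ e, v ∈ H).card + N₀.card = N.card := by
      convert Finset.card_filter_add_card_filter_not (s := N) fun e => ∃ v ∈ e, v ∈ H
    have hmeet := hN.card_filter_exists_mem_le H
    have hunion : (N₀ ∪ N₁).card = N₀.card + A.card := by
      rw [Finset.card_union_of_disjoint hdisj, hN₁,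
        Finset.card_image_of_injective _ hinj, Finset.card_attach]
    exact ⟨by omega, by omega⟩

theorem stmt_14 {V : Type*} [Fintype V] [DecidableEq V]
    (G : SimpleGraph V) [DecidableRel G.Adj]
    (α ε : ℝ) (hα : 1 ≤ α) (hε0 : 0 < ε) (hε1 : ε ≤ 1)
    (Δ : ℕ) (hΔ : 5 * (5 / ε + 1) * (2 * α) ≤ (Δ : ℝ))
    -- arboricity at most α
    (harb : ∀ S : Finset V, 2 ≤ S.card →
      ((G.edgeFinset.filter fun e => ∀ v ∈ e, v ∈ S).card : ℝ) ≤ α * ((S.card : ℝ) - 1))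
    -- each vertex marks up to Δ incident edges
    (M : V → Finset (Sym2 V))
    (hMinc : ∀ v : V, M v ⊆ G.incidenceFinset v)
    (hMcard : ∀ v : V, (M v).card ≤ Δ)
    -- vertices of degree < Δ mark all their incident edges
    (hMlow : ∀ v : V, G.degree v < Δ → M v = G.incidenceFinset v)
    -- vertices of degree ≥ Δ mark exactly Δ incident edges
    (hMhigh : ∀ v : V, Δ ≤ G.degree v → (M v).card = Δ) :
    -- maximum matching size of G is at most (1+ε) times that of G_Δ
    ∀ N : Finset (Sym2 V), IsMatchingIn G.edgeSet N →
      ∃ N' : Finset (Sym2 V),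
        IsMatchingIn {e | e ∈ G.edgeSet ∧ ∀ v ∈ e, e ∈ M v} N' ∧
        (N.card : ℝ) ≤ (1 + ε) * (N'.card : ℝ) := by
  intro N hN
  have hα0 : 0 < α := by linarith
  set H := univ.filter fun v => Δ ≤ G.degree v with hH
  set C := N.biUnion Sym2.toFinset with hC
  set T : V → Finset V := fun v => univ.filter fun w => s(v, w) ∈ M v ∧ w ∉ C ∪ H with hT
  set A := H.filter fun v => 4 * α ≤ ((T v).card : ℝ) with hA
  set B := H.filter fun v => ¬ 4 * α ≤ ((T v).card : ℝ) with hB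
  have hMadj : ∀ v w, s(v, w) ∈ M v → G.Adj v w := by
    intro v w hw
    have hinc := hMinc v hw
    rw [SimpleGraph.mem_incidenceFinset] at hinc
    exact hinc.1
  have hlow : ∀ v, v ∉ H → ∀ e ∈ G.edgeSet, v ∈ e → e ∈ M v := by
    intro v hv e he hve
    rw [hMlow v (by simpa [hH] using hv), SimpleGraph.mem_incidenceFinset]
    exact ⟨he, hve⟩
  obtain ⟨f, hfinj, hfT⟩ := exists_injective_of_four_mul_le_card G hα0 harb A T
    (fun v w hw => hMadj v w (Finset.mem_filter.1 hw).2.1)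
    (fun v hv => (Finset.mem_filter.1 hv).2)
  have hfM : ∀ v : A, s((v : V), f v) ∈ M v := fun v => (Finset.mem_filter.1 (hfT v)).2.1
  have hfCH : ∀ v : A, f v ∉ C ∧ f v ∉ H := fun v => by
    simpa only [Finset.mem_union, not_or] using (Finset.mem_filter.1 (hfT v)).2.2
  obtain ⟨N', hN', hAcard, hcard⟩ := hN.union_image (A := A)
    (t := {e | e ∈ G.edgeSet ∧ ∀ v ∈ e, e ∈ M v}) (Finset.filter_subset _ H)
    (fun e he heH => ⟨hN.1 he, fun v hv => hlow v (heH v hv) e (hN.1 he) hv⟩) hfinj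
    (fun v => by
      refine ⟨hMadj _ _ (hfM v), fun w hw => ?_⟩
      rcases Sym2.mem_iff.1 hw with rfl | rfl
      · exact hfM v
      · exact hlow _ (hfCH v).2 _ (hMadj _ _ (hfM v)) (Sym2.mem_mk_right _ _))
    (fun v => (hfCH v).2)
    (fun v e he hve => (hfCH v).1
      (Finset.mem_biUnion.2 ⟨e, he, Sym2.mem_toFinset.2 hve⟩))
  refine ⟨N', hN', ?_⟩
  have hAB : A.card + B.card = H.card :=
    Finset.card_filter_add_card_filter_not _
  have hCcard : C.card ≤ N.card * 2 :=
    Finset.card_biUnion_le_card_mul _ _ _ fun e _ => by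
      rw [Sym2.card_toFinset]; split_ifs <;> omega
  have hdeg : (B.card : ℝ) * (Δ - 4 * α) ≤
      ((∑ v ∈ B, ((C ∪ H).filter (G.Adj v)).card : ℕ) : ℝ) := by
    rw [Nat.cast_sum, ← nsmul_eq_mul]
    refine Finset.card_nsmul_le_sum _ _ _ fun v hv => ?_
    obtain ⟨hvH, hvT⟩ := Finset.mem_filter.1 hv
    have hle := card_le_add_card_filter_adj G (hMinc v) (C ∪ H)
    rw [hMhigh v (Finset.mem_filter.1 hvH).2] at hle
    have hle' : (Δ : ℝ) ≤ (T v).card + ((C ∪ H).filter (G.Adj v)).card := by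
      exact_mod_cast hle
    linarith
  have hBsub : B ⊆ C ∪ H :=
    (Finset.filter_subset _ _).trans Finset.subset_union_right
  have hmono : ((∑ v ∈ B, ((C ∪ H).filter (G.Adj v)).card : ℕ) : ℝ) ≤
      ((∑ v ∈ C ∪ H, ((C ∪ H).filter (G.Adj v)).card : ℕ) : ℝ) := by
    exact_mod_cast Finset.sum_le_sum_of_subset hBsub
  have hup := sum_card_adj_le G hα0.le harb (C ∪ H)
  have hunion : ((C ∪ H).card : ℝ) ≤ 2 * N.card + (A.card + B.card) := by
    have := Finset.card_union_le C H
    exact_mod_cast (by omega : (C ∪ H).card ≤ 2 * N.card + (A.card + B.card))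
  have hAN' : (A.card : ℝ) ≤ N'.card := by exact_mod_cast hAcard
  have hNB : (N.card : ℝ) ≤ N'.card + B.card := by
    exact_mod_cast (by omega : N.card ≤ N'.card + B.card)
  have hα_le : α * (50 / ε) + 10 * α ≤ Δ := by
    calc α * (50 / ε) + 10 * α = 5 * (5 / ε + 1) * (2 * α) := by ring
      _ ≤ Δ := hΔ
  have hBα : α * ((B.card : ℝ) * (50 / ε)) ≤ α * (2 * (2 * N.card + N'.card)) := by
    have hmul := mul_le_mul_of_nonneg_left hα_le (Nat.cast_nonneg (α := ℝ) B.card)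
    have hunion' := mul_le_mul_of_nonneg_left hunion (by positivity : 0 ≤ 2 * α)
    have hA' := mul_le_mul_of_nonneg_left hAN' (by positivity : 0 ≤ 2 * α)
    have hB0 : 0 ≤ α * (B.card : ℝ) := by positivity
    nlinarith
  have hBε : 25 * (B.card : ℝ) ≤ ε * (2 * N.card + N'.card) := by
    have h := le_of_mul_le_mul_left hBα hα0
    rw [mul_div_assoc', div_le_iff₀ hε0] at h
    linarith
  have hn0 : (0 : ℝ) ≤ N.card := Nat.cast_nonneg _
  have hn0' : (0 : ℝ) ≤ N'.card := Nat.cast_nonneg _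
  have hεn : 0 ≤ ε * N'.card := by positivity
  have hsmall : ε * (N.card : ℝ) ≤ N.card := mul_le_of_le_one_left hn0 hε1
  have hsmall' : ε * (N'.card : ℝ) ≤ N'.card := mul_le_of_le_one_left hn0' hε1
  have htwo : (N.card : ℝ) ≤ 2 * N'.card := by linarith
  nlinarith [mul_le_mul_of_nonneg_left htwo hε0.le]
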